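/- There is a universal constant C such that the following holds. Let D be a generic distribution over valuation profiles, and consider the empirical distribution over k i.i.d. sampled valuation profiles with k ≥ C·(1/ε²)·(m² + m·log n + log(1/δ)). Then with probability at least 1 − δ, for every price vector p and every item j, |π̂_j(p) − π_j(p)| < ε, where π_j(p) and π̂_j(p) are the probabilities that item j is sold by the sequential posted-price mechanism at prices p under D and under the empirical distribution, respectively. -/

import Mathlib

open scoped BigOperators

/-- A valuation is a real-valued set function on bundles of the `m` items. -/
abbrev Val (m : ℕ) := Finset (Fin m) → ℝ

/-- A (normalized, monotone) valuation. -/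
def IsValuation {m : ℕ} (v : Val m) : Prop :=
  v ∅ = 0 ∧ ∀ A B : Finset (Fin m), A ⊆ B → v A ≤ v B

/-- XOS (fractionally subadditive) valuations: a pointwise maximum of finitely many
nonnegative additive functions. -/
def IsXOS {m : ℕ} (v : Val m) : Prop :=
  ∃ (k : ℕ) (a : Fin (k + 1) → Fin m → ℝ),
    (∀ ℓ j, 0 ≤ a ℓ j) ∧ ∀ B : Finset (Fin m), v B = ⨆ ℓ, ∑ j ∈ B, a ℓ j

/-- An allocation: pairwise disjoint bundles. -/
def IsAlloc {n m : ℕ} (A : Fin n → Finset (Fin m)) : Prop :=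
  ∀ i i' : Fin n, i ≠ i' → Disjoint (A i) (A i')

/-- The optimal offline welfare of a valuation profile. -/
noncomputable def OPT {n m : ℕ} (v : Fin n → Val m) : ℝ :=
  ⨆ A : {A : Fin n → Finset (Fin m) // IsAlloc A}, ∑ i, v i (A.1 i)

/-- `B` is a demand set of valuation `v` at prices `p` among the available items `M`:
it maximizes the utility `v(B) - Σ_{j ∈ B} p j` over subsets of `M`. -/
def IsDemand {m : ℕ} (v : Val m) (p : Fin m → ℝ) (M : Finset (Fin m))
    (B : Finset (Fin m)) : Prop :=
  B ⊆ M ∧ ∀ B' ⊆ M, v B' - ∑ j ∈ B', p j ≤ v B - ∑ j ∈ B, p j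

/-- `a` is an additive supporting function of `v` on `B`. -/
def IsSupport {m : ℕ} (v : Val m) (B : Finset (Fin m)) (a : Fin m → ℝ) : Prop :=
  (∀ j, 0 ≤ a j) ∧ (∀ j, j ∉ B → a j = 0) ∧
  (∀ B' : Finset (Fin m), ∑ j ∈ B', a j ≤ v B') ∧ ∑ j ∈ B, a j = v B

/-- The least power of two that is at least `x` (by convention `0` for `x ≤ 0`). -/
noncomputable def pow2ceil (x : ℝ) : ℝ :=
  if x ≤ 0 then 0 else (2 : ℝ) ^ (⌈Real.logb 2 x⌉ : ℤ)

open MeasureTheory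
open scoped ENNReal

variable {n m : ℕ}

/-- The set of items still available after the first `i` buyers have bought, in the
sequential posted-price mechanism at prices `q`, where buyer `i` (with valuation
`v i`) buys the bundle `sel i (v i) q M` from the available items `M`. -/
def availN (sel : Fin n → Val m → (Fin m → ℝ) → Finset (Fin m) → Finset (Fin m))
    (q : Fin m → ℝ) (v : Fin n → Val m) : ℕ → Finset (Fin m)
  | 0 => Finset.univ
  | i + 1 =>
      if h : i < n then
        availN sel q v i \ sel ⟨i, h⟩ (v ⟨i, h⟩) q (availN sel q v i)
      else availN sel q v i

/-- The set of items sold by the sequential posted-price mechanism. -/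
def soldSet (sel : Fin n → Val m → (Fin m → ℝ) → Finset (Fin m) → Finset (Fin m))
    (q : Fin m → ℝ) (v : Fin n → Val m) : Finset (Fin m) :=
  Finset.univ \ availN sel q v n

/-- The bundle bought by buyer `i` in the sequential posted-price mechanism. -/
def buys (sel : Fin n → Val m → (Fin m → ℝ) → Finset (Fin m) → Finset (Fin m))
    (q : Fin m → ℝ) (v : Fin n → Val m) (i : Fin n) : Finset (Fin m) :=
  sel i (v i) q (availN sel q v i.1)

/-- A distribution over single valuations is generic: for every price vector and every
set of available items, with probability zero there exist two distinct demand sets. -/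
def Generic1 {m : ℕ} (D : Measure (Val m)) : Prop :=
  ∀ (q : Fin m → ℝ) (M : Finset (Fin m)),
    D {v : Val m | ∃ B1 B2 : Finset (Fin m),
      B1 ≠ B2 ∧ IsDemand v q M B1 ∧ IsDemand v q M B2} = 0

/-- A joint distribution over valuation profiles is generic: each buyer's marginal is
generic. -/
def Generic {n m : ℕ} (D : Measure (Fin n → Val m)) : Prop :=
  ∀ (i : Fin n) (q : Fin m → ℝ) (M : Finset (Fin m)),
    D {v : Fin n → Val m | ∃ B1 B2 : Finset (Fin m),
      B1 ≠ B2 ∧ IsDemand (v i) q M B1 ∧ IsDemand (v i) q M B2} = 0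

/-- The empirical distribution over `k` sampled valuation profiles. -/
noncomputable def empDist {n m k : ℕ} (S : Fin k → (Fin n → Val m)) :
    Measure (Fin n → Val m) :=
  (k : ℝ≥0∞)⁻¹ • ∑ t : Fin k, Measure.dirac (S t)

/-- Prices `p` are `α`-median for the distribution `μ` (with demand sets chosen by the
rule `sel`): each item sells with probability at most `1 - α`, and each item of
positive price sells with probability at least `α`. -/
def IsMedian {n m : ℕ} (μ : Measure (Fin n → Val m))
    (sel : Fin n → Val m → (Fin m → ℝ) → Finset (Fin m) → Finset (Fin m))
    (α : ℝ) (p : Fin m → ℝ) : Prop :=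
  ∀ j : Fin m,
    μ {v : Fin n → Val m | j ∈ soldSet sel p v} ≤ ENNReal.ofReal (1 - α) ∧
    (0 < p j → ENNReal.ofReal α ≤ μ {v : Fin n → Val m | j ∈ soldSet sel p v})

section

open Finset

theorem sign_convexCombo_eq {a b t : ℝ} {s : SignType} (ha : SignType.sign a = s)
    (hb : SignType.sign b = s) (ht0 : 0 ≤ t) (ht1 : t ≤ 1) :
    SignType.sign ((1 - t) * a + t * b) = s := by
  rcases lt_trichotomy a 0 with h | h | h
  · rw [sign_neg h] at ha
    subst ha
    rw [sign_eq_neg_one_iff] at hb ⊢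
    rcases ht0.eq_or_lt with rfl | h0
    · simpa using h
    · nlinarith [mul_neg_of_pos_of_neg h0 hb]
  · subst h
    rw [sign_zero] at ha
    subst ha
    rw [sign_eq_zero_iff] at hb
    simp [hb]
  · rw [sign_pos h] at ha
    subst ha
    rw [sign_eq_one_iff] at hb ⊢
    rcases ht0.eq_or_lt with rfl | h0
    · simpa using h
    · nlinarith [mul_pos h0 hb]

/-- If two reals have different signs, some convex combination of them vanishes. -/
theorem exists_convexCombo_eq_zero {a b : ℝ} (h : SignType.sign a ≠ SignType.sign b) :
    ∃ t : ℝ, 0 ≤ t ∧ t ≤ 1 ∧ (1 - t) * a + t * b = 0 := by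
  rcases le_total 0 a with ha | ha <;> rcases le_total 0 b with hb | hb
  · rcases ha.eq_or_lt with rfl | ha'
    · exact ⟨0, by simp⟩
    rcases hb.eq_or_lt with rfl | hb'
    · exact ⟨1, by simp⟩
    exact absurd ((sign_pos ha').trans (sign_pos hb').symm) h
  · rcases ha.eq_or_lt with rfl | ha'
    · exact ⟨0, by simp⟩
    have hab : 0 < a - b := by linarith
    refine ⟨a / (a - b), by positivity, (div_le_one hab).2 (by linarith), ?_⟩
    field_simp
    ring
  · rcases ha.eq_or_lt with rfl | ha'
    · exact ⟨0, by simp⟩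
    have hab : 0 < b - a := by linarith
    refine ⟨-a / (b - a), div_nonneg (by linarith) hab.le, (div_le_one hab).2 (by linarith), ?_⟩
    field_simp
    ring
  · rcases ha.eq_or_lt with rfl | ha'
    · exact ⟨0, by simp⟩
    rcases hb.eq_or_lt with rfl | hb'
    · exact ⟨1, by simp⟩
    exact absurd ((sign_neg ha').trans (sign_neg hb').symm) h

/-- The number of faces of an arrangement of `N` hyperplanes in an affine space of
dimension `d` is at most `(3 N + 1) ^ d`. -/
theorem ncard_signPatterns_le {V : Type*} [AddCommGroup V] [Module ℝ V]
    [FiniteDimensional ℝ V] : ∀ (N : ℕ) (f : Fin N → V →ₗ[ℝ] ℝ) (c : Fin N → ℝ)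
    (K : Submodule ℝ V) (p₀ : V),
    {σ : Fin N → SignType | ∃ q ∈ K, ∀ i, σ i = SignType.sign (f i (p₀ + q) + c i)}.ncard ≤
      (3 * N + 1) ^ Module.finrank ℝ K := by
  intro N
  induction N with
  | zero =>
    intro f c K p₀
    rw [Nat.mul_zero, Nat.zero_add, one_pow]
    exact Set.ncard_le_one_of_subsingleton _
  | succ N ih =>
    intro f c K p₀
    set Q := {σ : Fin N → SignType | ∃ q ∈ K, ∀ i : Fin N,
      σ i = SignType.sign (f i.succ (p₀ + q) + c i.succ)} with hQ
    have hQcard : Q.ncard ≤ (3 * N + 1) ^ Module.finrank ℝ K :=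
      ih (fun i => f i.succ) (fun i => c i.succ) K p₀
    by_cases hK : K ≤ LinearMap.ker (f 0)
    · calc _ ≤ ((fun σ : Fin N → SignType =>
            (Fin.cons (SignType.sign (f 0 p₀ + c 0)) σ : Fin (N + 1) → SignType)) '' Q).ncard := by
            refine Set.ncard_le_ncard ?_ (Set.toFinite _)
            rintro σ ⟨q, hq, hσ⟩
            refine ⟨Fin.tail σ, ⟨q, hq, fun i => hσ i.succ⟩, ?_⟩
            have h0 : f 0 q = 0 := hK hq
            have h1 : SignType.sign (f 0 p₀ + c 0) = σ 0 := by rw [hσ 0, (f 0).map_add, h0, add_zero]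
            simp only [h1]
            exact Fin.cons_self_tail σ
        _ ≤ Q.ncard := Set.ncard_image_le (Set.toFinite _)
        _ ≤ _ := hQcard.trans (Nat.pow_le_pow_left (by lia) _)
    · obtain ⟨q₁, hq₁, hne⟩ := SetLike.not_le_iff_exists.1 hK
      have hne' : f 0 q₁ ≠ 0 := hne
      set q₀ := (-(f 0 p₀ + c 0) / f 0 q₁) • q₁ with hq₀
      have hq₀K : q₀ ∈ K := K.smul_mem _ hq₁
      have hzero : f 0 (p₀ + q₀) + c 0 = 0 := by
        rw [hq₀, map_add, map_smul, smul_eq_mul]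
        field_simp
        ring
      have hlt : Module.finrank ℝ ↥(K ⊓ LinearMap.ker (f 0)) < Module.finrank ℝ K :=
        Submodule.finrank_lt_finrank_of_lt (inf_lt_left.2 hK)
      set R := {σ : Fin N → SignType | ∃ q ∈ K ⊓ LinearMap.ker (f 0), ∀ i : Fin N,
        σ i = SignType.sign (f i.succ (p₀ + q₀ + q) + c i.succ)} with hR
      have hRcard : R.ncard ≤ (3 * N + 1) ^ Module.finrank ℝ ↥(K ⊓ LinearMap.ker (f 0)) :=
        ih (fun i => f i.succ) (fun i => c i.succ) _ (p₀ + q₀)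
      have hex : ∀ σ : Fin N → SignType, ∃ q, σ ∈ Q → q ∈ K ∧ ∀ i : Fin N,
          σ i = SignType.sign (f i.succ (p₀ + q) + c i.succ) := by
        intro σ
        by_cases hσ : σ ∈ Q
        · obtain ⟨q, hq⟩ := hσ
          exact ⟨q, fun _ => hq⟩
        · exact ⟨0, fun h => absurd h hσ⟩
      choose w hw using hex
      have hsub : {σ : Fin (N + 1) → SignType | ∃ q ∈ K, ∀ i,
          σ i = SignType.sign (f i (p₀ + q) + c i)} ⊆
          ((fun σ : Fin N → SignType =>
            (Fin.cons (SignType.sign (f 0 (p₀ + w σ) + c 0)) σ : Fin (N + 1) → SignType)) '' Q) ∪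
          ((fun x : SignType × (Fin N → SignType) =>
            (Fin.cons x.1 x.2 : Fin (N + 1) → SignType)) '' (Set.univ ×ˢ R)) := by
        rintro σ ⟨q, hq, hσ⟩
        have hτQ : Fin.tail σ ∈ Q := ⟨q, hq, fun i => hσ i.succ⟩
        obtain ⟨hwK, hwσ⟩ := hw _ hτQ
        by_cases hs : SignType.sign (f 0 (p₀ + w (Fin.tail σ)) + c 0) = σ 0
        · left
          refine ⟨Fin.tail σ, hτQ, ?_⟩
          simp only [hs]
          exact Fin.cons_self_tail σ
        · right
          refine ⟨(σ 0, Fin.tail σ), ⟨Set.mem_univ _, ?_⟩, Fin.cons_self_tail σ⟩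
          rw [hσ 0] at hs
          obtain ⟨t, ht0, ht1, ht⟩ := exists_convexCombo_eq_zero hs
          set r := (1 - t) • w (Fin.tail σ) + t • q with hr
          have hrK : r ∈ K := K.add_mem (K.smul_mem _ hwK) (K.smul_mem _ hq)
          have haff : ∀ i, f i (p₀ + r) + c i =
              (1 - t) * (f i (p₀ + w (Fin.tail σ)) + c i) + t * (f i (p₀ + q) + c i) := by
            intro i
            simp only [hr, map_add, map_smul, smul_eq_mul]
            ring
          refine ⟨r - q₀, ⟨K.sub_mem hrK hq₀K, ?_⟩, fun i => ?_⟩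
          · have h1 := haff 0
            rw [ht] at h1
            simp only [map_add] at h1 hzero
            simp only [SetLike.mem_coe, LinearMap.mem_ker, map_sub]
            linarith
          · rw [show p₀ + q₀ + (r - q₀) = p₀ + r by abel, haff]
            exact (sign_convexCombo_eq (hwσ i).symm (hσ i.succ).symm ht0 ht1).symm
      have hpow : (3 * N + 1) ^ Module.finrank ℝ K +
          3 * (3 * N + 1) ^ Module.finrank ℝ ↥(K ⊓ LinearMap.ker (f 0)) ≤
          (3 * (N + 1) + 1) ^ Module.finrank ℝ K := by
        obtain ⟨d, hd⟩ : ∃ d, Module.finrank ℝ K = d + 1 := ⟨_, (Nat.succ_pred_eq_of_pos (by lia)).symm⟩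
        rw [hd] at hlt ⊢
        have h1 := Nat.pow_le_pow_right (show 0 < 3 * N + 1 by lia) (Nat.lt_succ_iff.1 hlt)
        have h2 : (3 * N + 1) ^ d ≤ (3 * (N + 1) + 1) ^ d := Nat.pow_le_pow_left (by lia) _
        calc _ ≤ (3 * N + 1) ^ d * (3 * N + 1) + 3 * (3 * N + 1) ^ d := by
              rw [pow_succ]; gcongr
          _ = (3 * N + 1) ^ d * (3 * (N + 1) + 1) := by ring
          _ ≤ (3 * (N + 1) + 1) ^ d * (3 * (N + 1) + 1) := by gcongr
          _ = _ := (pow_succ _ _).symm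
      have h3 : ((Set.univ : Set SignType) ×ˢ R).ncard = 3 * R.ncard := by
        rw [Set.ncard_prod, Set.ncard_univ]
        simp [Nat.card_eq_fintype_card]
        left; rfl
      calc _ ≤ _ := Set.ncard_le_ncard hsub (Set.toFinite _)
        _ ≤ _ := Set.ncard_union_le _ _
        _ ≤ Q.ncard + 3 * R.ncard := by
          rw [← h3]
          exact Nat.add_le_add (Set.ncard_image_le (Set.toFinite _))
            (Set.ncard_image_le (Set.toFinite _))
        _ ≤ _ := by
          refine le_trans ?_ hpow
          gcongr

end

section

open Finset

/-- A family of sets that are pairwise far apart is separated by some short tuple of points. -/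
theorem exists_tuple_injOn_trace {k s : ℕ} (hk : 0 < k) (F : Finset (Finset (Fin k))) {θ : ℝ}
    (hsep : ∀ U ∈ F, ∀ V ∈ F, U ≠ V → θ * k ≤ ((symmDiff U V).card : ℝ))
    (hs : (F.card : ℝ) ^ 2 * Real.exp (-(θ * s)) < 1) :
    ∃ y : Fin s → Fin k, Set.InjOn (fun U : Finset (Fin k) => univ.filter fun t => y t ∈ U) F := by
  by_contra! hcon
  have hcover : (univ : Finset (Fin s → Fin k)) ⊆
      F.offDiag.biUnion fun UV => Fintype.piFinset fun _ : Fin s => (symmDiff UV.1 UV.2)ᶜ := by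
    intro y _
    have hy := hcon y
    simp only [Set.InjOn, not_forall] at hy
    obtain ⟨U, hU, V, hV, heq, hne⟩ := hy
    simp only [mem_biUnion, mem_offDiag, Fintype.mem_piFinset, mem_compl]
    refine ⟨(U, V), ⟨hU, hV, hne⟩, fun t => ?_⟩
    have := Finset.ext_iff.1 heq t
    simp only [mem_filter, mem_univ, true_and] at this
    simp only [mem_symmDiff]
    tauto
  have hcard : ∀ UV ∈ F.offDiag,
      ((Fintype.piFinset fun _ : Fin s => (symmDiff UV.1 UV.2)ᶜ).card : ℝ) ≤
        (k : ℝ) ^ s * Real.exp (-(θ * s)) := by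
    rintro ⟨U, V⟩ hUV
    obtain ⟨hU, hV, hne⟩ := mem_offDiag.1 hUV
    rw [Fintype.card_piFinset, prod_const, card_univ, Fintype.card_fin, card_compl,
      Fintype.card_fin, Nat.cast_pow,
      Nat.cast_sub ((card_le_univ _).trans_eq (Fintype.card_fin k))]
    have h1 : (k : ℝ) - (symmDiff U V).card ≤ k * Real.exp (-θ) := by
      have h2 := hsep U hU V hV hne
      have h3 : 1 - θ ≤ Real.exp (-θ) := by linarith [Real.add_one_le_exp (-θ)]
      nlinarith [mul_le_mul_of_nonneg_left h3 (Nat.cast_nonneg (α := ℝ) k)]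
    have h0 : (0 : ℝ) ≤ k - (symmDiff U V).card := by
      rw [sub_nonneg]
      exact_mod_cast (card_le_univ _).trans_eq (Fintype.card_fin k)
    calc _ ≤ (k * Real.exp (-θ)) ^ s := pow_le_pow_left₀ h0 h1 s
      _ = _ := by rw [mul_pow, ← Real.exp_nat_mul]; congr 2; ring
  have hks : (0 : ℝ) < (k : ℝ) ^ s := by positivity
  have htot : (k : ℝ) ^ s ≤ (F.card : ℝ) ^ 2 * ((k : ℝ) ^ s * Real.exp (-(θ * s))) := by
    calc (k : ℝ) ^ s = ((univ : Finset (Fin s → Fin k)).card : ℝ) := by simp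
      _ ≤ ((F.offDiag.biUnion fun UV =>
            Fintype.piFinset fun _ : Fin s => (symmDiff UV.1 UV.2)ᶜ).card : ℝ) := by
          exact_mod_cast card_le_card hcover
      _ ≤ ∑ UV ∈ F.offDiag,
            ((Fintype.piFinset fun _ : Fin s => (symmDiff UV.1 UV.2)ᶜ).card : ℝ) := by
          exact_mod_cast card_biUnion_le
      _ ≤ ∑ _UV ∈ F.offDiag, (k : ℝ) ^ s * Real.exp (-(θ * s)) := sum_le_sum hcard
      _ = F.offDiag.card * ((k : ℝ) ^ s * Real.exp (-(θ * s))) := by simp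
      _ ≤ _ := by
          gcongr
          rw [offDiag_card, sq]
          exact_mod_cast Nat.sub_le _ _
  nlinarith

/-- Packing bound for a family of sets of polynomial growth. -/
theorem log_card_le_of_separated {k : ℕ} (hk : 0 < k) (F : Finset (Finset (Fin k)))
    {θ a : ℝ} {b : ℕ} (hθ0 : 0 < θ) (hθ1 : θ ≤ 1) (hb : 1 ≤ b) (ha : 0 < a) (hba : (b : ℝ) ≤ a)
    (hsep : ∀ U ∈ F, ∀ V ∈ F, U ≠ V → θ * k ≤ ((symmDiff U V).card : ℝ))
    (hgrowth : ∀ s : ℕ, 1 ≤ s → ∀ y : Fin s → Fin k,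
      ((F.image fun U => univ.filter fun t => y t ∈ U).card : ℝ) ≤ (a * s) ^ b) :
    Real.log F.card ≤ b * (4 * Real.log a + 2 * Real.log (1 / θ) + 2) := by
  have hb' : (1 : ℝ) ≤ b := by exact_mod_cast hb
  have ha1 : 1 ≤ a := hb'.trans hba
  have hla : 0 ≤ Real.log a := Real.log_nonneg ha1
  have hlθ : 0 ≤ Real.log (1 / θ) := Real.log_nonneg (by rw [le_div_iff₀ hθ0]; linarith)
  rcases F.eq_empty_or_nonempty with rfl | hF
  · simp only [card_empty, Nat.cast_zero, Real.log_zero]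
    positivity
  have hFpos : (0 : ℝ) < F.card := by exact_mod_cast hF.card_pos
  set h := Real.log F.card with hh
  have hh0 : 0 ≤ h := Real.log_nonneg (by exact_mod_cast hF.card_pos)
  set s := ⌊2 * h / θ⌋₊ + 1 with hsdef
  have hs1 : 2 * h / θ < s := by rw [hsdef]; push_cast; exact Nat.lt_floor_add_one _
  have hs2 : (s : ℝ) ≤ (2 * h + 1) / θ := by
    rw [hsdef]; push_cast
    have := Nat.floor_le (show 0 ≤ 2 * h / θ by positivity)
    rw [add_div]
    gcongr
    rw [le_div_iff₀ hθ0]; linarith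
  have hspos : (0 : ℝ) < s := lt_of_le_of_lt (by positivity) hs1
  obtain ⟨y, hy⟩ := exists_tuple_injOn_trace (s := s) hk F hsep (by
    rw [← Real.exp_log hFpos, ← hh, ← Real.exp_nat_mul, ← Real.exp_add, Real.exp_lt_one_iff]
    rw [div_lt_iff₀ hθ0] at hs1
    push_cast
    linarith)
  have hg := hgrowth s (by lia) y
  rw [card_image_of_injOn hy] at hg
  have hlog : h ≤ b * (Real.log a + Real.log s) := by
    have := Real.log_le_log hFpos hg
    rwa [Real.log_pow, Real.log_mul ha.ne' hspos.ne'] at this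
  set u := h / b with hu
  have hu0 : 0 ≤ u := by positivity
  have hhu : h = b * u := by rw [hu]; field_simp
  have hlogs : Real.log s ≤ Real.log a + (u / 2 + 1) + Real.log (1 / θ) := by
    have h4 : Real.log 4 ≤ 1.4 := by
      rw [show (4 : ℝ) = 2 ^ 2 by norm_num, Real.log_pow]
      have := Real.log_two_lt_d9
      push_cast; linarith
    have hu2 : Real.log (2 * u + 1) ≤ u / 2 + 1 := by
      have h5 := Real.log_le_sub_one_of_pos (show 0 < (2 * u + 1) / 4 by positivity)
      rw [Real.log_div (by positivity) (by norm_num)] at h5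
      linarith
    have h6 : (s : ℝ) ≤ a * (2 * u + 1) * (1 / θ) := by
      refine hs2.trans ?_
      rw [div_eq_mul_one_div]
      gcongr
      rw [hhu]
      nlinarith [mul_le_mul_of_nonneg_right hba hu0]
    have h7 := Real.log_le_log hspos h6
    rw [Real.log_mul (by positivity) (by positivity), Real.log_mul (by positivity) (by positivity)]
      at h7
    linarith
  have hule : u ≤ 2 * Real.log a + Real.log (1 / θ) + u / 2 + 1 := by
    rw [hhu] at hlog
    have := le_of_mul_le_mul_left hlog (by linarith)
    linarith
  rw [hhu]
  exact mul_le_mul_of_nonneg_left (by linarith) (by linarith)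

/-- The real number `1` or `-1` attached to a Boolean. -/
def boolSign (c : Bool) : ℝ := if c then 1 else -1

theorem card_rademacher_sum_ge_le {k : ℕ} (c : Fin k → ℝ) {v s : ℝ} (hv : 0 < v) (hs : 0 ≤ s)
    (hc : ∑ t, c t ^ 2 ≤ v) :
    ((univ.filter fun σ : Fin k → Bool => s ≤ ∑ t, boolSign (σ t) * c t).card : ℝ) ≤
      2 ^ k * Real.exp (-(s ^ 2 / (2 * v))) := by
  set l := s / v with hl
  have hl0 : 0 ≤ l := by positivity
  have hmgf : ∑ σ : Fin k → Bool, Real.exp (l * ∑ t, boolSign (σ t) * c t) ≤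
      2 ^ k * Real.exp (l ^ 2 * v / 2) := by
    have h1 : ∑ σ : Fin k → Bool, Real.exp (l * ∑ t, boolSign (σ t) * c t) =
        ∏ t, (2 * Real.cosh (l * c t)) := by
      have h2 : ∀ t, 2 * Real.cosh (l * c t) =
          ∑ e : Bool, Real.exp (l * (boolSign e * c t)) := by
        intro t
        rw [Fintype.sum_bool, Real.cosh_eq]
        simp only [boolSign, if_true, Bool.false_eq_true, if_false, one_mul, neg_mul, mul_neg]
        ring
      simp only [h2, Finset.prod_univ_sum, Fintype.piFinset_univ, mul_sum, Real.exp_sum]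
    rw [h1, prod_mul_distrib, prod_const, card_univ, Fintype.card_fin]
    gcongr
    calc ∏ t, Real.cosh (l * c t) ≤ ∏ t, Real.exp ((l * c t) ^ 2 / 2) :=
          prod_le_prod (fun _ _ => (Real.cosh_pos _).le) fun t _ => Real.cosh_le_exp_half_sq _
      _ = Real.exp (l ^ 2 * (∑ t, c t ^ 2) / 2) := by
          rw [← Real.exp_sum, mul_sum, sum_div]
          simp only [mul_pow]
      _ ≤ _ := by gcongr
  have hmarkov : ((univ.filter fun σ : Fin k → Bool => s ≤ ∑ t, boolSign (σ t) * c t).card : ℝ) *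
      Real.exp (l * s) ≤ ∑ σ : Fin k → Bool, Real.exp (l * ∑ t, boolSign (σ t) * c t) := by
    rw [← nsmul_eq_mul]
    refine (card_nsmul_le_sum _ (fun σ : Fin k → Bool => Real.exp (l * ∑ t, boolSign (σ t) * c t))
      _ fun σ hσ => ?_).trans
      (sum_le_sum_of_subset_of_nonneg (filter_subset _ _) fun _ _ _ => (Real.exp_pos _).le)
    have := (mem_filter.1 hσ).2
    gcongr
  have hexp : Real.exp (l ^ 2 * v / 2) = Real.exp (-(s ^ 2 / (2 * v))) * Real.exp (l * s) := by
    rw [← Real.exp_add]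
    congr 1
    rw [hl]
    field_simp
    ring
  have := hmarkov.trans hmgf
  rw [hexp, ← mul_assoc] at this
  exact le_of_mul_le_mul_right this (Real.exp_pos _)

theorem card_abs_rademacher_sum_ge_le {k : ℕ} (c : Fin k → ℝ) {v s : ℝ} (hv : 0 < v) (hs : 0 ≤ s)
    (hc : ∑ t, c t ^ 2 ≤ v) :
    ((univ.filter fun σ : Fin k → Bool => s ≤ |∑ t, boolSign (σ t) * c t|).card : ℝ) ≤
      2 * (2 ^ k * Real.exp (-(s ^ 2 / (2 * v)))) := by
  have h1 := card_rademacher_sum_ge_le c hv hs hc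
  have h2 := card_rademacher_sum_ge_le (fun t => -c t) hv hs (by simpa using hc)
  have hsub : (univ.filter fun σ : Fin k → Bool => s ≤ |∑ t, boolSign (σ t) * c t|) ⊆
      (univ.filter fun σ : Fin k → Bool => s ≤ ∑ t, boolSign (σ t) * c t) ∪
      (univ.filter fun σ : Fin k → Bool => s ≤ ∑ t, boolSign (σ t) * -c t) := by
    intro σ hσ
    simp only [mem_filter, mem_univ, true_and, mem_union, mul_neg, sum_neg_distrib] at hσ ⊢
    exact le_abs.1 hσ
  have h3 := (card_le_card hsub).trans (card_union_le _ _)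
  have h4 : ((univ.filter fun σ : Fin k → Bool => s ≤ |∑ t, boolSign (σ t) * c t|).card : ℝ) ≤
      (univ.filter fun σ : Fin k → Bool => s ≤ ∑ t, boolSign (σ t) * c t).card +
      (univ.filter fun σ : Fin k → Bool => s ≤ ∑ t, boolSign (σ t) * -c t).card := by
    exact_mod_cast h3
  linarith

/-- Existence of an `r`-net consisting of points more than `r` apart. -/
theorem exists_separated_net {k : ℕ} (A : Finset (Finset (Fin k))) (r : ℝ) (hr : 0 ≤ r) :
    ∃ F ⊆ A, (∀ U ∈ F, ∀ V ∈ F, U ≠ V → r ≤ ((symmDiff U V).card : ℝ)) ∧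
      ∀ U ∈ A, ∃ V ∈ F, ((symmDiff U V).card : ℝ) ≤ r := by
  induction A using Finset.induction with
  | empty => exact ⟨∅, by simp⟩
  | insert W A _ ih =>
    obtain ⟨F, hFA, hsep, hnet⟩ := ih
    by_cases hW : ∃ V ∈ F, ((symmDiff W V).card : ℝ) ≤ r
    · refine ⟨F, hFA.trans (subset_insert _ _), hsep, fun U hU => ?_⟩
      rcases mem_insert.1 hU with rfl | hU
      · exact hW
      · exact hnet U hU
    · push Not at hW
      refine ⟨insert W F, insert_subset_insert _ hFA, fun U hU V hV hne => ?_, fun U hU => ?_⟩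
      · rcases mem_insert.1 hU with rfl | hU₁ <;> rcases mem_insert.1 hV with rfl | hV₁
        · exact absurd rfl hne
        · exact (hW V hV₁).le
        · rw [symmDiff_comm]; exact (hW U hU₁).le
        · exact hsep U hU₁ V hV₁ hne
      · rcases mem_insert.1 hU with rfl | hU
        · exact ⟨U, mem_insert_self _ _, by simpa using hr⟩
        · obtain ⟨V, hV, h⟩ := hnet U hU
          exact ⟨V, mem_insert_of_mem hV, h⟩

end

section

open Finset

theorem sum_boolSign_sub_sum_boolSign {k : ℕ} (σ : Fin k → Bool) (U V : Finset (Fin k)) :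
    ∑ t ∈ U, boolSign (σ t) - ∑ t ∈ V, boolSign (σ t) =
      ∑ t, boolSign (σ t) * ((if t ∈ U then 1 else 0) - if t ∈ V then 1 else 0) := by
  simp [mul_sub, sum_sub_distrib]

theorem sum_sq_indicator_sub_eq_card_symmDiff {k : ℕ} (U V : Finset (Fin k)) :
    ∑ t, ((if t ∈ U then (1 : ℝ) else 0) - if t ∈ V then (1 : ℝ) else 0) ^ 2 =
      ((symmDiff U V).card : ℝ) := by
  have h : ∀ t, ((if t ∈ U then (1 : ℝ) else 0) - if t ∈ V then (1 : ℝ) else 0) ^ 2 =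
      if t ∈ symmDiff U V then 1 else 0 := by
    intro t
    by_cases h1 : t ∈ U <;> by_cases h2 : t ∈ V <;> simp [mem_symmDiff, h1, h2]
  simp only [h, sum_boole, filter_mem_eq_inter, univ_inter]

/-- Chaining bound for the Rademacher process of a family of sets of polynomial growth. -/
theorem card_exists_rademacher_large_le {k : ℕ} (hk : 0 < k) (A : Finset (Finset (Fin k)))
    {a ε δ : ℝ} {b : ℕ} (hb : 1 ≤ b) (ha : 1 ≤ Real.log a) (hba : (b : ℝ) ≤ a)
    (hε : 0 < ε) (hδ0 : 0 < δ) (hδ1 : δ ≤ 1)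
    (hgrowth : ∀ s : ℕ, 1 ≤ s → ∀ y : Fin s → Fin k,
      ((A.image fun U => univ.filter fun t => y t ∈ U).card : ℝ) ≤ (a * s) ^ b)
    (hkε : 18432 * (b * Real.log a + Real.log (1 / δ)) ≤ k * ε ^ 2) :
    ((univ.filter fun σ : Fin k → Bool =>
      ∃ U ∈ A, k * ε / 4 ≤ |∑ t ∈ U, boolSign (σ t)|).card : ℝ) ≤ 2 ^ k * (δ / 4) := by
  have hb' : (1 : ℝ) ≤ b := by exact_mod_cast hb
  have ha0 : 0 < a := by linarith
  have hk' : (0 : ℝ) < k := by exact_mod_cast hk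
  have hlδ : 0 ≤ Real.log (1 / δ) := Real.log_nonneg (by rw [le_div_iff₀ hδ0]; linarith)
  set W := b * Real.log a + Real.log (1 / δ) with hW
  have hbW : b * Real.log a ≤ W := by linarith
  have hbW' : (b : ℝ) ≤ W := by nlinarith
  have hW1 : 1 ≤ W := hb'.trans hbW'
  choose F hFA hsep hnet using fun l : ℕ =>
    exists_separated_net A ((1 / 4 : ℝ) ^ l * k) (by positivity)
  -- The nets are not too large.
  have hFcard : ∀ l, ((F l).card : ℝ) ≤ Real.exp (6 * W * (1 + l)) := by
    intro l
    rcases (F l).eq_empty_or_nonempty with h | h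
    · rw [h]; simp; positivity
    have hpos : (0 : ℝ) < (F l).card := by exact_mod_cast h.card_pos
    have hl := log_card_le_of_separated hk (F l) (θ := (1 / 4 : ℝ) ^ l) (by positivity)
      (pow_le_one₀ (by norm_num) (by norm_num)) hb ha0 hba (hsep l) fun s hs y => by
        refine le_trans ?_ (hgrowth s hs y)
        exact_mod_cast card_le_card (image_subset_image (hFA l))
    rw [← Real.log_le_iff_le_exp hpos]
    refine hl.trans ?_
    have h4 : Real.log (1 / (1 / 4 : ℝ) ^ l) ≤ 1.5 * l := by
      rw [one_div, ← inv_pow, Real.log_pow, one_div, inv_inv, show (4 : ℝ) = 2 ^ 2 by norm_num,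
        Real.log_pow]
      have := Real.log_two_lt_d9
      push_cast
      nlinarith [Nat.cast_nonneg (α := ℝ) l]
    have h5 : (b : ℝ) * l ≤ W * l := by gcongr
    have h6 : (b : ℝ) * (4 * Real.log a + 2 * Real.log (1 / (1 / 4 : ℝ) ^ l) + 2) ≤
        b * (4 * Real.log a + 2 * (1.5 * l) + 2) := by gcongr
    nlinarith [Nat.cast_nonneg (α := ℝ) l]
  -- Each element of a net is close to an element of the previous one.
  have hpar : ∀ (l : ℕ) (V : Finset (Fin k)), ∃ P : Finset (Fin k), V ∈ F l →
      ((symmDiff V P).card : ℝ) ≤ 4 * ((1 / 4 : ℝ) ^ l * k) ∧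
        ((l = 0 ∧ P = ∅) ∨ ∃ l', l = l' + 1 ∧ P ∈ F l') := by
    intro l V
    by_cases hV : V ∈ F l
    · rcases l with _ | l
      · refine ⟨∅, fun _ => ⟨?_, Or.inl ⟨rfl, rfl⟩⟩⟩
        have : ((symmDiff V ∅).card : ℝ) ≤ k := by
          exact_mod_cast (card_le_univ _).trans_eq (Fintype.card_fin k)
        simp only [pow_zero]
        linarith
      · obtain ⟨P, hP, hd⟩ := hnet l V (hFA _ hV)
        refine ⟨P, fun _ => ⟨hd.trans_eq ?_, Or.inr ⟨l, rfl, hP⟩⟩⟩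
        rw [pow_succ]; ring
    · exact ⟨∅, fun h => absurd h hV⟩
  choose par hpar using hpar
  set gap : ℕ → ℝ := fun l => k * ε / 16 * (3 / 4) ^ l with hgap
  set bad : ℕ → Finset (Fin k → Bool) := fun l => (F l).biUnion fun V => univ.filter fun σ =>
    gap l ≤ |∑ t, boolSign (σ t) *
      ((if t ∈ V then 1 else 0) - if t ∈ par l V then 1 else 0)| with hbad
  have hbadcard : ∀ l, ((bad l).card : ℝ) ≤ 2 ^ k * (δ / 8 * (1 / 2) ^ l) := by
    intro l
    have hlink : ∀ V ∈ F l, ((univ.filter fun σ : Fin k → Bool => gap l ≤ |∑ t, boolSign (σ t) *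
        ((if t ∈ V then 1 else 0) - if t ∈ par l V then 1 else 0)|).card : ℝ) ≤
        2 * (2 ^ k * Real.exp (-(9 * W * (1 + l)))) := by
      intro V hV
      refine (card_abs_rademacher_sum_ge_le _ (v := 4 * ((1 / 4 : ℝ) ^ l * k)) (by positivity)
        (by positivity) ((sum_sq_indicator_sub_eq_card_symmDiff V (par l V)).trans_le
          (hpar l V hV).1)).trans ?_
      gcongr
      have h1 : gap l ^ 2 / (2 * (4 * ((1 / 4 : ℝ) ^ l * k))) = k * ε ^ 2 / 2048 * (9 / 4) ^ l := by
        rw [hgap]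
        have : ((9 : ℝ) / 4) ^ l = ((3 / 4) ^ l) ^ 2 / (1 / 4) ^ l := by
          rw [← pow_mul, mul_comm l 2, pow_mul, ← div_pow]; norm_num
        rw [this]
        field_simp
        norm_num
      rw [h1]
      have h2 : (1 + l : ℝ) ≤ (9 / 4) ^ l := by
        have := one_add_mul_le_pow (show (-2 : ℝ) ≤ 5 / 4 by norm_num) l
        norm_num at this
        nlinarith [Nat.cast_nonneg (α := ℝ) l]
      calc 9 * W * (1 + l) ≤ k * ε ^ 2 / 2048 * (1 + l) := by gcongr; linarith
        _ ≤ _ := by gcongr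
    have hsum : ((bad l).card : ℝ) ≤
        (F l).card * (2 * (2 ^ k * Real.exp (-(9 * W * (1 + l))))) := by
      refine le_trans (Nat.cast_le.2 card_biUnion_le) ?_
      rw [Nat.cast_sum, ← nsmul_eq_mul]
      exact sum_le_card_nsmul _ _ _ hlink
    have hexp : Real.exp (6 * W * (1 + l)) * Real.exp (-(9 * W * (1 + l))) ≤
        δ / 16 * (1 / 2) ^ l := by
      rw [← Real.exp_add]
      have he1 : Real.exp (-1) ≤ 1 / 2 := by
        rw [Real.exp_neg, one_div]
        exact inv_anti₀ (by norm_num) (by linarith [Real.add_one_le_exp (1 : ℝ)])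
      have he3 : Real.exp (-3) ≤ 1 / 16 := by
        rw [show (-3 : ℝ) = -(3 : ℕ) by norm_num, Real.exp_neg, ← mul_one ((3 : ℕ) : ℝ),
          Real.exp_nat_mul, one_div]
        refine inv_anti₀ (by norm_num) ?_
        have h27 : (2.7 : ℝ) ≤ Real.exp 1 := by linarith [Real.exp_one_gt_d9]
        calc (16 : ℝ) ≤ 2.7 ^ 3 := by norm_num
          _ ≤ _ := pow_le_pow_left₀ (by norm_num) h27 3
      have hδe : Real.exp (-Real.log (1 / δ)) = δ := by
        rw [Real.exp_neg, Real.exp_log (by positivity), one_div, inv_inv]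
      calc Real.exp (6 * W * (1 + l) + -(9 * W * (1 + l)))
          ≤ Real.exp (-Real.log (1 / δ) + -3 + l * (-1)) := by
            refine Real.exp_le_exp.2 ?_
            have h1 : (l : ℝ) ≤ W * l := le_mul_of_one_le_left (Nat.cast_nonneg l) hW1
            have h2 : (1 : ℝ) ≤ b * Real.log a := one_le_mul_of_one_le_of_one_le hb' ha
            linarith
        _ = δ * Real.exp (-3) * Real.exp (-1) ^ l := by
            rw [Real.exp_add, Real.exp_add, hδe, Real.exp_nat_mul]
        _ ≤ δ * (1 / 16) * (1 / 2) ^ l := by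
            gcongr
        _ = _ := by ring
    calc ((bad l).card : ℝ) ≤ _ := hsum
      _ ≤ Real.exp (6 * W * (1 + l)) * (2 * (2 ^ k * Real.exp (-(9 * W * (1 + l))))) := by
        gcongr; exact hFcard l
      _ = 2 ^ k * (2 * (Real.exp (6 * W * (1 + l)) * Real.exp (-(9 * W * (1 + l))))) := by ring
      _ ≤ 2 ^ k * (2 * (δ / 16 * (1 / 2) ^ l)) := by gcongr
      _ = _ := by ring
  obtain ⟨L, hL⟩ : ∃ L : ℕ, (1 / 4 : ℝ) ^ L * k < 1 := by
    obtain ⟨L, hL⟩ := exists_pow_lt_of_lt_one (show (0 : ℝ) < 1 / k by positivity)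
      (show (1 / 4 : ℝ) < 1 by norm_num)
    exact ⟨L, by rwa [lt_div_iff₀ hk'] at hL⟩
  have hsmall : ∀ σ, (∀ l ∈ range (L + 1), σ ∉ bad l) → ∀ l ≤ L, ∀ V ∈ F l,
      |∑ t ∈ V, boolSign (σ t)| < k * ε / 4 * (1 - (3 / 4) ^ (l + 1)) := by
    intro σ hσ l
    induction l with
    | zero =>
      intro hl V hV
      have h1 := hσ 0 (by simp)
      simp only [hbad, mem_biUnion, mem_filter, mem_univ, true_and, not_exists, not_and,
        not_le] at h1
      have h2 := h1 V hV
      rw [← sum_boolSign_sub_sum_boolSign] at h2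
      obtain ⟨-, ⟨-, hP⟩ | ⟨l', hl', -⟩⟩ := hpar 0 V hV
      · rw [hP, sum_empty, sub_zero] at h2
        refine h2.trans_le (le_of_eq ?_)
        rw [hgap]; ring
      · lia
    | succ l ih =>
      intro hl V hV
      have h1 := hσ (l + 1) (by simp; lia)
      simp only [hbad, mem_biUnion, mem_filter, mem_univ, true_and, not_exists, not_and,
        not_le] at h1
      have h2 := h1 V hV
      rw [← sum_boolSign_sub_sum_boolSign] at h2
      obtain ⟨-, ⟨h0, -⟩ | ⟨l', hl', hP⟩⟩ := hpar (l + 1) V hV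
      · lia
      · obtain rfl : l = l' := by lia
        have h3 := ih (by lia) _ hP
        have h4 := abs_add_le (∑ t ∈ V, boolSign (σ t) - ∑ t ∈ par (l + 1) V, boolSign (σ t))
          (∑ t ∈ par (l + 1) V, boolSign (σ t))
        rw [sub_add_cancel] at h4
        refine lt_of_lt_of_le (h4.trans_lt (add_lt_add h2 h3)) (le_of_eq ?_)
        rw [hgap]; ring
  have hsub : (univ.filter fun σ : Fin k → Bool =>
      ∃ U ∈ A, k * ε / 4 ≤ |∑ t ∈ U, boolSign (σ t)|) ⊆ (range (L + 1)).biUnion bad := by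
    intro σ hσ
    simp only [mem_filter, mem_univ, true_and] at hσ
    obtain ⟨U, hU, hlarge⟩ := hσ
    by_contra hcon
    simp only [mem_biUnion, not_exists, not_and] at hcon
    obtain ⟨V, hV, hd⟩ := hnet L U hU
    have h0 : (symmDiff U V).card = 0 := by
      have := hd.trans_lt hL
      exact Nat.lt_one_iff.1 (by exact_mod_cast this)
    have hUV : U = V := symmDiff_eq_bot.1 (card_eq_zero.1 h0)
    have h1 := hsmall σ hcon L le_rfl V hV
    rw [← hUV] at h1
    have h2 : 0 < k * ε / 4 * (3 / 4 : ℝ) ^ (L + 1) := by positivity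
    linarith
  calc _ ≤ (((range (L + 1)).biUnion bad).card : ℝ) := by exact_mod_cast card_le_card hsub
    _ ≤ ∑ l ∈ range (L + 1), ((bad l).card : ℝ) := by exact_mod_cast card_biUnion_le
    _ ≤ ∑ l ∈ range (L + 1), 2 ^ k * (δ / 8 * (1 / 2) ^ l) := sum_le_sum fun l _ => hbadcard l
    _ = 2 ^ k * (δ / 8 * ∑ l ∈ range (L + 1), (1 / 2 : ℝ) ^ l) := by simp only [mul_sum]
    _ ≤ 2 ^ k * (δ / 8 * 2) := by
      gcongr
      exact sum_geometric_two_le _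
    _ = _ := by ring

end

section

open Finset

open Classical in
/-- The traces left on the finite sample `x` by the sets of the class `A`. -/
noncomputable def samplePatterns {X P ι : Type*} [Fintype ι] (A : P → Set X) (x : ι → X) :
    Finset (Finset ι) :=
  univ.filter fun T => ∃ p, ∀ t, t ∈ T ↔ x t ∈ A p

theorem mem_samplePatterns {X P ι : Type*} [Fintype ι] {A : P → Set X} {x : ι → X}
    {T : Finset ι} : T ∈ samplePatterns A x ↔ ∃ p, ∀ t, t ∈ T ↔ x t ∈ A p := by
  simp [samplePatterns]

/-- Chebyshev's inequality for the empirical frequency of an event. -/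
theorem measure_pi_empirical_deviation_le {X : Type*} [MeasurableSpace X] (D : Measure X)
    [IsProbabilityMeasure D] {A : Set X} (hA : MeasurableSet A) {k : ℕ} {ε : ℝ} (hε : 0 < ε)
    (hkε : 8 ≤ k * ε ^ 2) :
    (Measure.pi fun _ : Fin k => D)
      {S | k * ε / 2 ≤ |∑ t, A.indicator (1 : X → ℝ) (S t) - k * D.real A|} ≤ 1 / 2 := by
  have hk : (0 : ℝ) < k := by
    by_contra h
    nlinarith [sq_nonneg ε]
  have hmem : MemLp (A.indicator (1 : X → ℝ)) 2 D :=
    memLp_indicator_const 2 hA 1 (Or.inr (measure_ne_top _ _))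
  have hY : ∀ t : Fin k, MemLp (fun S : Fin k → X => A.indicator (1 : X → ℝ) (S t)) 2
      (Measure.pi fun _ : Fin k => D) := fun t =>
    hmem.comp_measurePreserving (measurePreserving_eval (fun _ : Fin k => D) t)
  have hsum : MemLp (∑ t : Fin k, fun S : Fin k → X => A.indicator (1 : X → ℝ) (S t)) 2
      (Measure.pi fun _ : Fin k => D) := memLp_finsetSum' _ fun t _ => hY t
  have hvar : ProbabilityTheory.variance
      (∑ t : Fin k, fun S : Fin k → X => A.indicator (1 : X → ℝ) (S t))
      (Measure.pi fun _ : Fin k => D) ≤ k := by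
    rw [ProbabilityTheory.variance_sum_pi (X := fun _ : Fin k => A.indicator (1 : X → ℝ))
      fun _ => hmem]
    calc _ ≤ ∑ _t : Fin k, (1 : ℝ) := by
          refine sum_le_sum fun t _ => ?_
          refine (ProbabilityTheory.variance_le_expectation_sq hmem.1).trans ?_
          have : (A.indicator (1 : X → ℝ)) ^ 2 = A.indicator 1 := by
            ext x
            by_cases hx : x ∈ A <;> simp [hx]
          rw [this, integral_indicator_one hA]
          exact measureReal_le_one
      _ = k := by simp
  have hmean : ∫ S, (∑ t : Fin k, fun S : Fin k → X => A.indicator (1 : X → ℝ) (S t)) S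
      ∂(Measure.pi fun _ : Fin k => D) = k * D.real A := by
    simp only [Finset.sum_apply]
    rw [integral_finsetSum _ fun t _ => (hY t).integrable (by norm_num)]
    have : ∀ t : Fin k, ∫ S : Fin k → X, A.indicator (1 : X → ℝ) (S t)
        ∂(Measure.pi fun _ : Fin k => D) = D.real A := by
      intro t
      rw [← integral_indicator_one hA]
      have hmp := measurePreserving_eval (fun _ : Fin k => D) t
      have hmap := integral_map hmp.aemeasurable (f := A.indicator (1 : X → ℝ))
        (measurable_one.indicator hA).aestronglyMeasurable
      rw [hmp.map_eq] at hmap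
      exact hmap.symm
    simp [this]
  have hcheb := ProbabilityTheory.meas_ge_le_variance_div_sq hsum
    (show 0 < k * ε / 2 by positivity)
  rw [hmean] at hcheb
  simp only [Finset.sum_apply] at hcheb
  refine hcheb.trans ?_
  rw [show (1 / 2 : ℝ≥0∞) = ENNReal.ofReal (1 / 2) by
    rw [ENNReal.ofReal_div_of_pos (by norm_num)]; simp]
  refine ENNReal.ofReal_le_ofReal ?_
  rw [div_le_iff₀ (by positivity)]
  nlinarith

theorem measurableSet_double_sample {X P : Type*} [MeasurableSpace X] {A : P → Set X}
    (hmeas : ∀ (ι : Type) [Fintype ι] (T : Finset ι),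
      MeasurableSet {x : ι → X | ∃ p, ∀ t, t ∈ T ↔ x t ∈ A p}) (k : ℕ) (c : ℝ) :
    MeasurableSet {z : Fin k → X × X | ∃ p, c ≤
      |∑ t, ((A p).indicator (1 : X → ℝ) (z t).1 - (A p).indicator 1 (z t).2)|} := by
  classical
  set g : (Fin k → X × X) → (Fin k ⊕ Fin k → X) :=
    fun z => Sum.elim (fun t => (z t).1) fun t => (z t).2 with hg
  have hgm : Measurable g := by
    refine measurable_pi_iff.2 ?_
    rintro (t | t)
    · exact measurable_fst.comp (measurable_pi_apply t)
    · exact measurable_snd.comp (measurable_pi_apply t)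
  have heq : {z : Fin k → X × X | ∃ p, c ≤
      |∑ t, ((A p).indicator (1 : X → ℝ) (z t).1 - (A p).indicator 1 (z t).2)|} =
      ⋃ T ∈ {T : Finset (Fin k ⊕ Fin k) | c ≤ |∑ t : Fin k,
        ((if Sum.inl t ∈ T then (1 : ℝ) else 0) - if Sum.inr t ∈ T then 1 else 0)|},
      g ⁻¹' {x | ∃ p, ∀ u, u ∈ T ↔ x u ∈ A p} := by
    ext z
    simp only [Set.mem_ofPred_eq, Set.mem_iUnion, Set.mem_preimage, exists_prop]
    constructor
    · rintro ⟨p, hp⟩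
      refine ⟨univ.filter fun u => g z u ∈ A p, ?_, p, fun u => by simp⟩
      simpa [hg, Set.indicator_apply] using hp
    · rintro ⟨T, hT, p, hp⟩
      refine ⟨p, ?_⟩
      simpa [hg, hp, Set.indicator_apply] using hT
  rw [heq]
  exact MeasurableSet.biUnion (Set.to_countable _) fun T _ => hgm (hmeas _ T)

/-- Conditionally on the double sample, random swaps rarely produce a large deviation. -/
theorem card_swap_deviation_le {X P : Type*} {A : P → Set X} {k : ℕ} (hk : 0 < k)
    {a ε δ : ℝ} {b : ℕ} (hb : 1 ≤ b) (ha : 1 ≤ Real.log a) (hba : (b : ℝ) ≤ a)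
    (hε : 0 < ε) (hδ0 : 0 < δ) (hδ1 : δ ≤ 1)
    (hgrowth : ∀ s : ℕ, 1 ≤ s → ∀ x : Fin s → X,
      ((samplePatterns A x).card : ℝ) ≤ (a * s) ^ b)
    (hkε : 18432 * (b * Real.log a + Real.log (1 / δ)) ≤ k * ε ^ 2)
    (x y : Fin k → X) [DecidablePred fun σ : Fin k → Bool => ∃ p, k * ε / 2 ≤
      |∑ t, boolSign (σ t) * ((A p).indicator (1 : X → ℝ) (x t) - (A p).indicator 1 (y t))|] :
    ((univ.filter fun σ : Fin k → Bool => ∃ p, k * ε / 2 ≤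
      |∑ t, boolSign (σ t) * ((A p).indicator (1 : X → ℝ) (x t) -
        (A p).indicator 1 (y t))|).card : ℝ) ≤ 2 ^ k * (δ / 2) := by
  classical
  have hone : ∀ x : Fin k → X, ((univ.filter fun σ : Fin k → Bool =>
      ∃ U ∈ samplePatterns A x, k * ε / 4 ≤ |∑ t ∈ U, boolSign (σ t)|).card : ℝ) ≤
      2 ^ k * (δ / 4) := by
    intro x
    refine card_exists_rademacher_large_le hk _ hb ha hba hε hδ0 hδ1 (fun s hs w => ?_) hkε
    refine le_trans ?_ (hgrowth s hs fun t => x (w t))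
    refine Nat.cast_le.2 (card_le_card ?_)
    intro T hT
    obtain ⟨U, hU, rfl⟩ := mem_image.1 hT
    obtain ⟨p, hp⟩ := mem_samplePatterns.1 hU
    exact mem_samplePatterns.2 ⟨p, fun t => by simp [hp]⟩
  have hsub : (univ.filter fun σ : Fin k → Bool => ∃ p, k * ε / 2 ≤
      |∑ t, boolSign (σ t) * ((A p).indicator (1 : X → ℝ) (x t) - (A p).indicator 1 (y t))|) ⊆
      (univ.filter fun σ : Fin k → Bool =>
        ∃ U ∈ samplePatterns A x, k * ε / 4 ≤ |∑ t ∈ U, boolSign (σ t)|) ∪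
      (univ.filter fun σ : Fin k → Bool =>
        ∃ U ∈ samplePatterns A y, k * ε / 4 ≤ |∑ t ∈ U, boolSign (σ t)|) := by
    intro σ hσ
    simp only [mem_filter, mem_univ, true_and, mem_union] at hσ ⊢
    obtain ⟨p, hp⟩ := hσ
    have hpat : ∀ x : Fin k → X, (univ.filter fun t => x t ∈ A p) ∈ samplePatterns A x ∧
        ∑ t ∈ univ.filter (fun t => x t ∈ A p), boolSign (σ t) =
          ∑ t, boolSign (σ t) * (A p).indicator (1 : X → ℝ) (x t) := by
      intro x
      refine ⟨mem_samplePatterns.2 ⟨p, fun t => by simp⟩, ?_⟩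
      simp [sum_filter, Set.indicator_apply]
    by_contra! hcon
    have h1 := hcon.1 _ (hpat x).1
    have h2 := hcon.2 _ (hpat y).1
    rw [(hpat _).2] at h1 h2
    simp only [mul_sub, sum_sub_distrib] at hp
    have h3 := abs_sub (∑ t, boolSign (σ t) * (A p).indicator (1 : X → ℝ) (x t))
      (∑ t, boolSign (σ t) * (A p).indicator (1 : X → ℝ) (y t))
    linarith
  have h1 := hone x
  have h2 := hone y
  have h3 := Nat.cast_le (α := ℝ).2 ((card_le_card hsub).trans (card_union_le _ _))
  push_cast at h3
  linarith

theorem measure_double_sample_le {X P : Type*} [MeasurableSpace X] (D : Measure X)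
    [IsProbabilityMeasure D] {A : P → Set X}
    (hmeas : ∀ (ι : Type) [Fintype ι] (T : Finset ι),
      MeasurableSet {x : ι → X | ∃ p, ∀ t, t ∈ T ↔ x t ∈ A p})
    {k : ℕ} (hk : 0 < k) {a ε δ : ℝ} {b : ℕ} (hb : 1 ≤ b) (ha : 1 ≤ Real.log a)
    (hba : (b : ℝ) ≤ a) (hε : 0 < ε) (hδ0 : 0 < δ) (hδ1 : δ ≤ 1)
    (hgrowth : ∀ s : ℕ, 1 ≤ s → ∀ x : Fin s → X,
      ((samplePatterns A x).card : ℝ) ≤ (a * s) ^ b)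
    (hkε : 18432 * (b * Real.log a + Real.log (1 / δ)) ≤ k * ε ^ 2) :
    (Measure.pi fun _ : Fin k => D.prod D) {z | ∃ p, k * ε / 2 ≤
      |∑ t, ((A p).indicator (1 : X → ℝ) (z t).1 - (A p).indicator 1 (z t).2)|} ≤
      ENNReal.ofReal (δ / 2) := by
  classical
  set B : Set (Fin k → X × X) := {z | ∃ p, k * ε / 2 ≤
    |∑ t, ((A p).indicator (1 : X → ℝ) (z t).1 - (A p).indicator 1 (z t).2)|} with hB
  have hBm : MeasurableSet B := measurableSet_double_sample hmeas k _
  set ν := Measure.pi fun _ : Fin k => D.prod D with hν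
  set τ : (Fin k → Bool) → (Fin k → X × X) → (Fin k → X × X) :=
    fun σ z t => (if σ t then id else Prod.swap) (z t) with hτ
  have hτm : ∀ σ, MeasurePreserving (τ σ) ν ν := by
    intro σ
    refine measurePreserving_pi _ _ fun t => ?_
    by_cases h : σ t
    · simpa [h] using MeasurePreserving.id _
    · simpa [h] using Measure.measurePreserving_swap
  have hτB : ∀ σ z, τ σ z ∈ B ↔ ∃ p, k * ε / 2 ≤ |∑ t, boolSign (σ t) *
      ((A p).indicator (1 : X → ℝ) (z t).1 - (A p).indicator 1 (z t).2)| := by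
    intro σ z
    have : ∀ p t, (A p).indicator (1 : X → ℝ) (τ σ z t).1 - (A p).indicator 1 (τ σ z t).2 =
        boolSign (σ t) * ((A p).indicator (1 : X → ℝ) (z t).1 - (A p).indicator 1 (z t).2) := by
      intro p t
      by_cases h : σ t <;> simp [hτ, h, boolSign]
    simp only [hB, Set.mem_ofPred_eq, this]
  have hsum : (2 : ℝ≥0∞) ^ k * ν B ≤ 2 ^ k * ENNReal.ofReal (δ / 2) := by
    calc (2 : ℝ≥0∞) ^ k * ν B = ∑ σ : Fin k → Bool, ν (τ σ ⁻¹' B) := by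
          simp [(hτm _).measure_preimage hBm.nullMeasurableSet]
      _ = ∑ σ : Fin k → Bool, ∫⁻ z, (τ σ ⁻¹' B).indicator 1 z ∂ν := by
          refine sum_congr rfl fun σ _ => ?_
          rw [lintegral_indicator_one ((hτm σ).measurable hBm)]
      _ = ∫⁻ z, ∑ σ : Fin k → Bool, (τ σ ⁻¹' B).indicator 1 z ∂ν := by
          rw [lintegral_finsetSum]
          exact fun σ _ => measurable_one.indicator ((hτm σ).measurable hBm)
      _ ≤ ∫⁻ _z, 2 ^ k * ENNReal.ofReal (δ / 2) ∂ν := by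
          refine lintegral_mono fun z => ?_
          have h1 := card_swap_deviation_le hk hb ha hba hε hδ0 hδ1 hgrowth hkε
            (fun t => (z t).1) fun t => (z t).2
          have h2 : ∑ σ : Fin k → Bool, (τ σ ⁻¹' B).indicator (1 : (Fin k → X × X) → ℝ≥0∞) z =
              ((univ.filter fun σ : Fin k → Bool => ∃ p, k * ε / 2 ≤ |∑ t, boolSign (σ t) *
                ((A p).indicator (1 : X → ℝ) (z t).1 - (A p).indicator 1 (z t).2)|).card :
                ℝ≥0∞) := by
            simp only [Set.indicator_apply, Set.mem_preimage, hτB, Pi.one_apply, sum_boole]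
          simp only [h2]
          rw [← ENNReal.ofReal_natCast]
          refine (ENNReal.ofReal_le_ofReal h1).trans_eq ?_
          rw [ENNReal.ofReal_mul (by positivity), ENNReal.ofReal_pow (by norm_num)]
          simp
      _ = _ := by simp
  exact (ENNReal.mul_le_mul_iff_right (by simp) (by simp)).1 hsum

/-- Uniform convergence of empirical frequencies over a class of sets of polynomial growth. -/
theorem measure_pi_uniform_deviation_le {X P : Type*} [MeasurableSpace X] (D : Measure X)
    [IsProbabilityMeasure D] {A : P → Set X} (hA : ∀ p, MeasurableSet (A p))
    (hmeas : ∀ (ι : Type) [Fintype ι] (T : Finset ι),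
      MeasurableSet {x : ι → X | ∃ p, ∀ t, t ∈ T ↔ x t ∈ A p})
    {k : ℕ} {a ε δ : ℝ} {b : ℕ} (hb : 1 ≤ b) (ha : 1 ≤ Real.log a)
    (hba : (b : ℝ) ≤ a) (hε : 0 < ε) (hδ0 : 0 < δ) (hδ1 : δ ≤ 1)
    (hgrowth : ∀ s : ℕ, 1 ≤ s → ∀ x : Fin s → X,
      ((samplePatterns A x).card : ℝ) ≤ (a * s) ^ b)
    (hkε : 18432 * (b * Real.log a + Real.log (1 / δ)) ≤ k * ε ^ 2) :
    (Measure.pi fun _ : Fin k => D) {S | ∃ p, k * ε ≤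
      |∑ t, (A p).indicator (1 : X → ℝ) (S t) - k * D.real (A p)|} ≤ ENNReal.ofReal δ := by
  have hkε8 : 8 ≤ k * ε ^ 2 := by
    have h1 : (1 : ℝ) ≤ b := by exact_mod_cast hb
    have h2 : 0 ≤ Real.log (1 / δ) := Real.log_nonneg (by rw [le_div_iff₀ hδ0]; linarith)
    nlinarith
  have hk : 0 < k := by
    rcases Nat.eq_zero_or_pos k with rfl | h
    · norm_num at hkε8
    · exact h
  set μ := Measure.pi fun _ : Fin k => D with hμ
  set B : Set (Fin k → X × X) := {z | ∃ p, k * ε / 2 ≤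
    |∑ t, ((A p).indicator (1 : X → ℝ) (z t).1 - (A p).indicator 1 (z t).2)|} with hB
  have hBm : MeasurableSet B := measurableSet_double_sample hmeas k _
  set e := MeasurableEquiv.arrowProdEquivProdArrow X X (Fin k) with he
  have hemp : MeasurePreserving e (Measure.pi fun _ : Fin k => D.prod D) (μ.prod μ) :=
    measurePreserving_arrowProdEquivProdArrow X X (Fin k) (fun _ => D) fun _ => D
  have hB' : MeasurableSet (e.symm ⁻¹' B) := e.symm.measurable hBm
  have hprod : μ.prod μ (e.symm ⁻¹' B) ≤ ENNReal.ofReal (δ / 2) := by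
    rw [← hemp.measure_preimage hB'.nullMeasurableSet, ← Set.preimage_comp, e.symm_comp_self,
      Set.preimage_id]
    exact measure_double_sample_le D hmeas hk hb ha hba hε hδ0 hδ1 hgrowth hkε
  have hfib : {S : Fin k → X | ∃ p, k * ε ≤
      |∑ t, (A p).indicator (1 : X → ℝ) (S t) - k * D.real (A p)|} ⊆
      {S | 1 / 2 ≤ μ (Prod.mk S ⁻¹' (e.symm ⁻¹' B))} := by
    rintro S ⟨p, hp⟩
    have hcheb := measure_pi_empirical_deviation_le D (hA p) hε hkε8
    have hcover : (Set.univ : Set (Fin k → X)) ⊆ (Prod.mk S ⁻¹' (e.symm ⁻¹' B)) ∪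
        {S | k * ε / 2 ≤ |∑ t, (A p).indicator (1 : X → ℝ) (S t) - k * D.real (A p)|} := by
      intro S' _
      by_cases h : k * ε / 2 ≤ |∑ t, (A p).indicator (1 : X → ℝ) (S' t) - k * D.real (A p)|
      · exact Or.inr h
      · refine Or.inl ⟨p, ?_⟩
        change k * ε / 2 ≤
          |∑ t, ((A p).indicator (1 : X → ℝ) (S t) - (A p).indicator 1 (S' t))|
        rw [sum_sub_distrib]
        have h1 := abs_sub_le (∑ t, (A p).indicator (1 : X → ℝ) (S t))
          (∑ t, (A p).indicator (1 : X → ℝ) (S' t)) (k * D.real (A p))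
        linarith
    have h1 : (1 : ℝ≥0∞) ≤ μ (Prod.mk S ⁻¹' (e.symm ⁻¹' B)) + 1 / 2 := by
      calc (1 : ℝ≥0∞) = μ Set.univ := measure_univ.symm
        _ ≤ _ := (measure_mono hcover).trans (measure_union_le _ _)
        _ ≤ _ := by gcongr
    have h2 : (1 / 2 : ℝ≥0∞) + 1 / 2 = 1 := by simp [ENNReal.inv_two_add_inv_two]
    refine (ENNReal.add_le_add_iff_right (a := 1 / 2) (by simp)).1 ?_
    rwa [h2]
  have hmarkov := mul_meas_ge_le_lintegral (μ := μ) (measurable_measure_prodMk_left (ν := μ) hB')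
    (1 / 2)
  rw [← Measure.prod_apply hB'] at hmarkov
  calc _ ≤ μ {S | 1 / 2 ≤ μ (Prod.mk S ⁻¹' (e.symm ⁻¹' B))} := measure_mono hfib
    _ = 2 * (1 / 2 * μ {S | 1 / 2 ≤ μ (Prod.mk S ⁻¹' (e.symm ⁻¹' B))}) := by
      rw [← mul_assoc, one_div, ENNReal.mul_inv_cancel (by simp) (by simp), one_mul]
    _ ≤ 2 * ENNReal.ofReal (δ / 2) := by gcongr; exact hmarkov.trans hprod
    _ = ENNReal.ofReal δ := by
      rw [← ENNReal.ofReal_ofNat 2, ← ENNReal.ofReal_mul (by norm_num)]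
      congr 1
      ring

end

/-- The utility of the bundle `B` minus the utility of the bundle `B'`. -/
def utilityGap {m : ℕ} (v : Val m) (p : Fin m → ℝ) (B B' : Finset (Fin m)) : ℝ :=
  (v B - ∑ j ∈ B, p j) - (v B' - ∑ j ∈ B', p j)

theorem isDemand_iff_sign_utilityGap {m : ℕ} {v : Val m} {p : Fin m → ℝ}
    {M B : Finset (Fin m)} : IsDemand v p M B ↔
      B ⊆ M ∧ ∀ B' ⊆ M, SignType.sign (utilityGap v p B B') ≠ -1 := by
  simp only [IsDemand, ne_eq, sign_eq_neg_one_iff, not_lt, utilityGap, sub_nonneg]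

/-- The bundle bought depends only on the signs of the utility differences. -/
theorem sel_congr_of_sign_utilityGap {n m : ℕ}
    {sel : Fin n → Val m → (Fin m → ℝ) → Finset (Fin m) → Finset (Fin m)}
    (hsel : ∀ i v q M, IsDemand v q M (sel i v q M))
    {ρ : Fin n → Finset (Fin m) → ℕ} (hρ : ∀ i, Function.Injective (ρ i))
    (hmax : ∀ i v q M B, IsDemand v q M B → ρ i B ≤ ρ i (sel i v q M))
    {i : Fin n} {v v' : Val m} {p p' : Fin m → ℝ}
    (h : ∀ B B', SignType.sign (utilityGap v p B B') = SignType.sign (utilityGap v' p' B B'))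
    (M : Finset (Fin m)) : sel i v p M = sel i v' p' M := by
  have hiff : ∀ B, IsDemand v p M B ↔ IsDemand v' p' M B := fun B => by
    simp only [isDemand_iff_sign_utilityGap, h]
  exact hρ i (le_antisymm (hmax _ _ _ _ _ ((hiff _).1 (hsel _ _ _ _)))
    (hmax _ _ _ _ _ ((hiff _).2 (hsel _ _ _ _))))

theorem soldSet_congr_of_sign_utilityGap {n m : ℕ}
    {sel : Fin n → Val m → (Fin m → ℝ) → Finset (Fin m) → Finset (Fin m)}
    (hsel : ∀ i v q M, IsDemand v q M (sel i v q M))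
    {ρ : Fin n → Finset (Fin m) → ℕ} (hρ : ∀ i, Function.Injective (ρ i))
    (hmax : ∀ i v q M B, IsDemand v q M B → ρ i B ≤ ρ i (sel i v q M))
    {v v' : Fin n → Val m} {p p' : Fin m → ℝ}
    (h : ∀ i B B', SignType.sign (utilityGap (v i) p B B') =
      SignType.sign (utilityGap (v' i) p' B B')) :
    soldSet sel p v = soldSet sel p' v' := by
  have havail : ∀ l, availN sel p v l = availN sel p' v' l := by
    intro l
    induction l with
    | zero => rfl
    | succ l ih =>
      simp only [availN, ih]
      split_ifs with hl
      · rw [sel_congr_of_sign_utilityGap hsel hρ hmax (h ⟨l, hl⟩)]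
      · rfl
  rw [soldSet, soldSet, havail]

/-- Closed sets of reals exhausting the reals of a given sign. -/
def signLevel (s : SignType) (r : ℕ) : Set ℝ :=
  match s with
  | 0 => {0}
  | 1 => Set.Ici (1 / ((r : ℝ) + 1))
  | -1 => Set.Iic (-(1 / ((r : ℝ) + 1)))

theorem isClosed_signLevel (s : SignType) (r : ℕ) : IsClosed (signLevel s r) := by
  cases s
  · exact isClosed_singleton
  · exact isClosed_Iic
  · exact isClosed_Ici

theorem sign_eq_of_mem_signLevel {s : SignType} {r : ℕ} {y : ℝ} (h : y ∈ signLevel s r) :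
    SignType.sign y = s := by
  have hr : (0 : ℝ) < 1 / ((r : ℝ) + 1) := by positivity
  cases s
  · exact sign_eq_zero_iff.2 h
  · exact sign_eq_neg_one_iff.2 (lt_of_le_of_lt h (neg_lt_zero.2 hr))
  · exact sign_eq_one_iff.2 (lt_of_lt_of_le hr h)

theorem eventually_mem_signLevel (y : ℝ) :
    ∀ᶠ r : ℕ in Filter.atTop, y ∈ signLevel (SignType.sign y) r := by
  have hlim := tendsto_one_div_add_atTop_nhds_zero_nat (𝕜 := ℝ)
  rcases lt_trichotomy y 0 with h | h | h
  · rw [sign_neg h]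
    filter_upwards [hlim.eventually (gt_mem_nhds (neg_pos.2 h))] with r hr
    exact (le_neg.2 hr.le)
  · subst h
    rw [sign_zero]
    exact Filter.Eventually.of_forall fun _ => rfl
  · rw [sign_pos h]
    filter_upwards [hlim.eventually (gt_mem_nhds h)] with r hr
    exact hr.le

/-- Realizability of a sign vector by a parameter from a closed set is a measurable event. -/
theorem measurableSet_exists_sign_eq {E I : Type*} [TopologicalSpace E] [MeasurableSpace E]
    [OpensMeasurableSpace E] [Finite I] {m : ℕ} {Z : Set (Fin m → ℝ)} (hZ : IsClosed Z)
    {g : I → E × (Fin m → ℝ) → ℝ} (hg : ∀ i, Continuous (g i)) (τ : I → SignType) :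
    MeasurableSet {x : E | ∃ p ∈ Z, ∀ i, SignType.sign (g i (x, p)) = τ i} := by
  have heq : {x : E | ∃ p ∈ Z, ∀ i, SignType.sign (g i (x, p)) = τ i} =
      ⋃ r : ℕ, {x : E | ∃ p ∈ Metric.closedBall 0 r ∩ Z, ∀ i, g i (x, p) ∈ signLevel (τ i) r} := by
    ext x
    simp only [Set.mem_ofPred_eq, Set.mem_iUnion]
    constructor
    · rintro ⟨p, hpZ, hp⟩
      have h1 : ∀ᶠ r : ℕ in Filter.atTop, ∀ i, g i (x, p) ∈ signLevel (τ i) r := by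
        rw [Filter.eventually_all]
        intro i
        rw [← hp i]
        exact eventually_mem_signLevel _
      have h2 : ∀ᶠ r : ℕ in Filter.atTop, ‖p‖ ≤ r :=
        tendsto_natCast_atTop_atTop.eventually (Filter.eventually_ge_atTop _)
      obtain ⟨r, hr1, hr2⟩ := (h1.and h2).exists
      exact ⟨r, p, ⟨mem_closedBall_zero_iff.2 hr2, hpZ⟩, hr1⟩
    · rintro ⟨r, p, hp, h⟩
      exact ⟨p, hp.2, fun i => sign_eq_of_mem_signLevel (h i)⟩
  rw [heq]
  refine MeasurableSet.iUnion fun r => IsClosed.measurableSet ?_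
  have hcompact : IsCompact (Metric.closedBall 0 r ∩ Z) := (isCompact_closedBall _ _).inter_right hZ
  have := isCompact_iff_compactSpace.1 hcompact
  have hclosed : IsClosed {y : E × ↥(Metric.closedBall 0 (r : ℝ) ∩ Z) |
      ∀ i, g i (y.1, y.2) ∈ signLevel (τ i) r} := by
    simp only [Set.ofPred_forall]
    refine isClosed_iInter fun i => (isClosed_signLevel _ _).preimage ?_
    exact (hg i).comp (by fun_prop)
  convert isClosedMap_fst_of_compactSpace _ hclosed using 1
  ext x
  simp

/-- Realizability of a sale pattern by a price vector from a closed set is a measurable event. -/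
theorem measurableSet_exists_sale_pattern {n m : ℕ}
    {sel : Fin n → Val m → (Fin m → ℝ) → Finset (Fin m) → Finset (Fin m)}
    (hsel : ∀ i v q M, IsDemand v q M (sel i v q M))
    {ρ : Fin n → Finset (Fin m) → ℕ} (hρ : ∀ i, Function.Injective (ρ i))
    (hmax : ∀ i v q M B, IsDemand v q M B → ρ i B ≤ ρ i (sel i v q M))
    (j : Fin m) {Z : Set (Fin m → ℝ)} (hZ : IsClosed Z) {ι : Type} [Fintype ι] (T : Finset ι) :
    MeasurableSet {x : ι → Fin n → Val m | ∃ p ∈ Z, ∀ t, t ∈ T ↔ j ∈ soldSet sel p (x t)} := by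
  set g : ι × Fin n × Finset (Fin m) × Finset (Fin m) →
      (ι → Fin n → Val m) × (Fin m → ℝ) → ℝ :=
    fun u y => utilityGap (y.1 u.1 u.2.1) y.2 u.2.2.1 u.2.2.2 with hg
  have hgc : ∀ u, Continuous (g u) := by
    intro u
    simp only [hg, utilityGap]
    fun_prop
  have heq : {x : ι → Fin n → Val m | ∃ p ∈ Z, ∀ t, t ∈ T ↔ j ∈ soldSet sel p (x t)} =
      ⋃ τ ∈ {τ : ι × Fin n × Finset (Fin m) × Finset (Fin m) → SignType |
        ∃ x, ∃ p, (∀ u, SignType.sign (g u (x, p)) = τ u) ∧ ∀ t, t ∈ T ↔ j ∈ soldSet sel p (x t)},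
      {x | ∃ p ∈ Z, ∀ u, SignType.sign (g u (x, p)) = τ u} := by
    ext x
    simp only [Set.mem_ofPred_eq, Set.mem_iUnion, exists_prop]
    constructor
    · rintro ⟨p, hpZ, hp⟩
      exact ⟨fun u => SignType.sign (g u (x, p)), ⟨x, p, fun _ => rfl, hp⟩, p, hpZ, fun _ => rfl⟩
    · rintro ⟨τ, ⟨x', p', hτ', hT⟩, p, hpZ, hτ⟩
      refine ⟨p, hpZ, fun t => ?_⟩
      rw [hT t, soldSet_congr_of_sign_utilityGap (v := x' t) (v' := x t) (p := p') (p' := p)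
        hsel hρ hmax fun i B B' =>
        (hτ' (t, i, B, B')).trans (hτ (t, i, B, B')).symm]
  rw [heq]
  exact MeasurableSet.biUnion (Set.to_countable _) fun τ _ =>
    measurableSet_exists_sign_eq hZ hgc τ

theorem measurableSet_sold {n m : ℕ}
    {sel : Fin n → Val m → (Fin m → ℝ) → Finset (Fin m) → Finset (Fin m)}
    (hsel : ∀ i v q M, IsDemand v q M (sel i v q M))
    {ρ : Fin n → Finset (Fin m) → ℕ} (hρ : ∀ i, Function.Injective (ρ i))
    (hmax : ∀ i v q M B, IsDemand v q M B → ρ i B ≤ ρ i (sel i v q M))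
    (j : Fin m) (p : Fin m → ℝ) : MeasurableSet {v : Fin n → Val m | j ∈ soldSet sel p v} := by
  have h := measurableSet_exists_sale_pattern hsel hρ hmax j (isClosed_singleton (x := p))
    (Finset.univ : Finset Unit)
  have hconst : Measurable fun (v : Fin n → Val m) (_ : Unit) => v :=
    measurable_pi_iff.2 fun _ => measurable_id
  simpa using hconst h

/-- Growth bound for the sale patterns of a fixed item on a sample of `s` profiles. -/
theorem card_samplePatterns_sold_le {n m : ℕ} (hn : 1 ≤ n)
    {sel : Fin n → Val m → (Fin m → ℝ) → Finset (Fin m) → Finset (Fin m)}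
    (hsel : ∀ i v q M, IsDemand v q M (sel i v q M))
    {ρ : Fin n → Finset (Fin m) → ℕ} (hρ : ∀ i, Function.Injective (ρ i))
    (hmax : ∀ i v q M B, IsDemand v q M B → ρ i B ≤ ρ i (sel i v q M))
    (j : Fin m) {s : ℕ} (hs : 1 ≤ s) (x : Fin s → Fin n → Val m) :
    ((samplePatterns (fun p : {p : Fin m → ℝ // ∀ j, 0 ≤ p j} =>
      {v : Fin n → Val m | j ∈ soldSet sel p.1 v}) x).card : ℝ) ≤ (4 * n * 4 ^ m * s) ^ m := by
  classical
  set I := Fin s × Fin n × Finset (Fin m) × Finset (Fin m) with hI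
  set N := Fintype.card I with hN
  have hNcard : N = s * (n * (2 ^ m * 2 ^ m)) := by simp [hN, hI]
  set e : Fin N ≃ I := (Fintype.equivFin I).symm with he
  set f : Fin N → (Fin m → ℝ) →ₗ[ℝ] ℝ := fun u =>
    ∑ j ∈ (e u).2.2.2, LinearMap.proj j - ∑ j ∈ (e u).2.2.1, LinearMap.proj j with hf
  set c : Fin N → ℝ := fun u =>
    x (e u).1 (e u).2.1 (e u).2.2.1 - x (e u).1 (e u).2.1 (e u).2.2.2 with hc
  have hfc : ∀ u p, f u p + c u =
      utilityGap (x (e u).1 (e u).2.1) p (e u).2.2.1 (e u).2.2.2 := by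
    intro u p
    simp only [hf, hc, utilityGap, LinearMap.sub_apply, LinearMap.sum_apply, LinearMap.proj_apply]
    ring
  have hcount := ncard_signPatterns_le N f c ⊤ 0
  rw [finrank_top, Module.finrank_fin_fun] at hcount
  set A := fun p : {p : Fin m → ℝ // ∀ j, 0 ≤ p j} =>
    {v : Fin n → Val m | j ∈ soldSet sel p.1 v} with hA
  have hex : ∀ T : Finset (Fin s), ∃ p : Fin m → ℝ, T ∈ samplePatterns A x →
      ∀ t, t ∈ T ↔ j ∈ soldSet sel p (x t) := by
    intro T
    by_cases hT : T ∈ samplePatterns A x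
    · obtain ⟨p, hp⟩ := mem_samplePatterns.1 hT
      exact ⟨p.1, fun _ => hp⟩
    · exact ⟨0, fun h => absurd h hT⟩
  choose price hprice using hex
  have hle : (samplePatterns A x).card ≤ (3 * N + 1) ^ m := by
    rw [← Set.ncard_coe_finset]
    refine le_trans (Set.ncard_le_ncard_of_injOn
      (fun T u => SignType.sign (f u (price T) + c u)) ?_ ?_ (Set.toFinite _)) hcount
    · intro T _
      exact ⟨price T, Submodule.mem_top, fun u => by rw [zero_add]⟩
    · intro T hT T' hT' hTT'
      ext t
      rw [hprice T hT, hprice T' hT']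
      rw [soldSet_congr_of_sign_utilityGap hsel hρ hmax fun i B B' => ?_]
      have := congrFun hTT' (e.symm (t, i, B, B'))
      simpa only [hfc, Equiv.apply_symm_apply] using this
  have hN1 : 1 ≤ N := by
    rw [hNcard]
    exact Nat.one_le_iff_ne_zero.2 (by positivity)
  calc ((samplePatterns A x).card : ℝ) ≤ (3 * N + 1) ^ m := by exact_mod_cast hle
    _ ≤ (4 * N) ^ m := by
      gcongr
      have : (1 : ℝ) ≤ N := by exact_mod_cast hN1
      linarith
    _ = _ := by
      rw [hNcard]
      push_cast
      rw [← mul_pow]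
      norm_num
      ring

theorem toReal_empDist_apply {n m k : ℕ} (S : Fin k → Fin n → Val m) {A : Set (Fin n → Val m)}
    (hA : MeasurableSet A) :
    ((empDist S) A).toReal = (k : ℝ)⁻¹ * ∑ t, A.indicator (1 : (Fin n → Val m) → ℝ) (S t) := by
  rw [empDist, Measure.smul_apply, smul_eq_mul, ENNReal.toReal_mul, ENNReal.toReal_inv,
    ENNReal.toReal_natCast, Measure.finsetSum_apply]
  congr 1
  rw [ENNReal.toReal_sum fun t _ => measure_ne_top _ _]
  refine Finset.sum_congr rfl fun t _ => ?_
  rw [Measure.dirac_apply' _ hA]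
  by_cases h : S t ∈ A <;> simp [h]

/-- **uniform convergence.** There is a universal constant `C` such
that for any generic distribution `D` over valuation profiles (ties in the sequential
posted-price mechanism resolved by a fixed deterministic tie-breaking rule, encoded by
the injective ranking functions `ρ i`, independent of prices and of the available
items) and any `ε, δ > 0`, for the empirical distribution over
`k ≥ C (1/ε²)(m² + m log n + log (1/δ))` i.i.d. sample profiles, with probability at
least `1 - δ`: for every nonnegative price vector `p` and every item `j`, the
probabilities that item `j` is sold at prices `p` under `D` and under the empirical
distribution differ by less than `ε`. -/
theorem stmt14 :
    ∃ C : ℝ, 0 < C ∧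
      ∀ (n m : ℕ) (D : Measure (Fin n → Val m)), IsProbabilityMeasure D →
        Generic D →
        ∀ (sel : Fin n → Val m → (Fin m → ℝ) → Finset (Fin m) → Finset (Fin m)),
          (∀ i v q M, IsDemand v q M (sel i v q M)) →
          ∀ ρ : Fin n → Finset (Fin m) → ℕ,
            (∀ i, Function.Injective (ρ i)) →
            (∀ i v q M B, IsDemand v q M B → ρ i B ≤ ρ i (sel i v q M)) →
            ∀ ε δ : ℝ, 0 < ε → 0 < δ →
              ∀ k : ℕ,
                C * (1 / ε ^ 2) * ((m : ℝ) ^ 2 + m * Real.log n + Real.log (1 / δ)) ≤ k →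
                (Measure.pi fun _ : Fin k => D)
                    {S : Fin k → (Fin n → Val m) |
                      ∀ p : Fin m → ℝ, (∀ j, 0 ≤ p j) →
                        ∀ j : Fin m,
                          |((empDist S) {v : Fin n → Val m | j ∈ soldSet sel p v}).toReal -
                              (D {v : Fin n → Val m | j ∈ soldSet sel p v}).toReal| < ε} ≥
                  ENNReal.ofReal (1 - δ) := by
  refine ⟨73728, by norm_num, ?_⟩
  intro n m D _ _ sel hsel ρ hρ hmax ε δ hε hδ k hk
  rcases le_or_gt 1 δ with hδ1 | hδ1
  · rw [ENNReal.ofReal_of_nonpos (by linarith)]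
    exact zero_le
  set μ := Measure.pi fun _ : Fin k => D with hμ
  rcases Nat.eq_zero_or_pos n with rfl | hn
  · have hempty : ∀ (p : Fin m → ℝ) (j : Fin m),
        {v : Fin 0 → Val m | j ∈ soldSet sel p v} = ∅ := by
      intro p j
      ext v
      simp [soldSet, availN]
    simp only [hempty, measure_empty, ENNReal.toReal_zero, sub_zero, abs_zero, hε, implies_true]
    rw [Set.ofPred_true, measure_univ]
    exact ENNReal.ofReal_le_one.2 (by linarith)
  rcases Nat.eq_zero_or_pos m with rfl | hm
  · simp only [IsEmpty.forall_iff, implies_true]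
    rw [Set.ofPred_true, measure_univ]
    exact ENNReal.ofReal_le_one.2 (by linarith)
  have hm1 : (1 : ℝ) ≤ m := by exact_mod_cast hm
  have hn1 : (1 : ℝ) ≤ n := by exact_mod_cast hn
  have hlogm : Real.log m ≤ m := (Real.log_le_sub_one_of_pos (by linarith)).trans (by linarith)
  have hlogm0 : 0 ≤ Real.log m := Real.log_nonneg hm1
  have hlogn0 : 0 ≤ Real.log n := Real.log_nonneg hn1
  have hlogδ0 : 0 ≤ Real.log (1 / δ) := Real.log_nonneg (by rw [le_div_iff₀ hδ]; linarith)
  have hlog4 : 1 ≤ Real.log 4 ∧ Real.log 4 ≤ 1.4 := by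
    rw [show (4 : ℝ) = 2 ^ 2 by norm_num, Real.log_pow]
    have h1 := Real.log_two_lt_d9
    have h2 := Real.log_two_gt_d9
    push_cast
    constructor <;> linarith
  set a : ℝ := 4 * n * 4 ^ m with ha
  have hloga : Real.log a = Real.log 4 + Real.log n + m * Real.log 4 := by
    rw [ha, Real.log_mul (by positivity) (by positivity),
      Real.log_mul (by norm_num) (by positivity), Real.log_pow]
  have hloga1 : 1 ≤ Real.log a := by
    rw [hloga]
    nlinarith
  have hma : (m : ℝ) ≤ a := by
    have h1 : (m : ℝ) ≤ 4 ^ m := by exact_mod_cast (Nat.lt_pow_self (by norm_num)).le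
    have h2 : (0 : ℝ) ≤ 4 ^ m := by positivity
    rw [ha]
    nlinarith
  have hkε : 73728 * ((m : ℝ) ^ 2 + m * Real.log n + Real.log (1 / δ)) ≤ k * ε ^ 2 := by
    have hε2 : 0 < ε ^ 2 := by positivity
    have := mul_le_mul_of_nonneg_right hk hε2.le
    refine le_trans (le_of_eq ?_) this
    field_simp
  have hkε' : 18432 * (m * Real.log a + Real.log (1 / (δ / m))) ≤ k * ε ^ 2 := by
    refine le_trans ?_ hkε
    have h1 : Real.log (1 / (δ / m)) = Real.log (1 / δ) + Real.log m := by
      rw [← Real.log_mul (by positivity) (by positivity)]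
      congr 1
      field_simp
    rw [h1, hloga]
    have h2 : (m : ℝ) * Real.log 4 ≤ m * 1.4 := by gcongr; exact hlog4.2
    have h3 : (m : ℝ) ^ 2 * Real.log 4 ≤ m ^ 2 * 1.4 := by gcongr; exact hlog4.2
    have h4 : 0 ≤ (m : ℝ) * Real.log n := by positivity
    nlinarith
  have hk0 : (0 : ℝ) < k := by
    by_contra h
    have h1 : (k : ℝ) = 0 := le_antisymm (not_lt.1 h) (Nat.cast_nonneg k)
    rw [h1, zero_mul] at hkε
    have h4 : 0 ≤ (m : ℝ) * Real.log n := by positivity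
    nlinarith
  set A : Fin m → {p : Fin m → ℝ // ∀ j, 0 ≤ p j} → Set (Fin n → Val m) :=
    fun j p => {v | j ∈ soldSet sel p.1 v} with hA
  have hAm : ∀ j p, MeasurableSet (A j p) := fun j p => measurableSet_sold hsel hρ hmax j p.1
  set bad : Fin m → Set (Fin k → Fin n → Val m) := fun j => {S | ∃ p, k * ε ≤
    |∑ t, (A j p).indicator (1 : (Fin n → Val m) → ℝ) (S t) - k * D.real (A j p)|} with hbad
  have hZ : IsClosed {p : Fin m → ℝ | ∀ j, 0 ≤ p j} := by
    simp only [Set.ofPred_forall]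
    exact isClosed_iInter fun j => isClosed_le continuous_const (continuous_apply j)
  have hbadle : ∀ j, μ (bad j) ≤ ENNReal.ofReal (δ / m) := by
    intro j
    refine measure_pi_uniform_deviation_le D (hAm j) (fun ι _ T => ?_) hm hloga1 hma hε
      (by positivity) ((div_le_one (by linarith)).2 (by linarith)) (fun s hs x => ?_) hkε'
    · simpa [hA] using measurableSet_exists_sale_pattern hsel hρ hmax j hZ T
    · exact card_samplePatterns_sold_le hn hsel hρ hmax j hs x
  set good : Set (Fin k → Fin n → Val m) := {S | ∀ p : Fin m → ℝ, (∀ j, 0 ≤ p j) → ∀ j : Fin m,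
    |((empDist S) {v : Fin n → Val m | j ∈ soldSet sel p v}).toReal -
      (D {v : Fin n → Val m | j ∈ soldSet sel p v}).toReal| < ε} with hgood
  have hcover : (Set.univ : Set (Fin k → Fin n → Val m)) ⊆ good ∪ ⋃ j, bad j := by
    intro S _
    by_cases hS : S ∈ good
    · exact Or.inl hS
    · right
      simp only [hgood, Set.mem_ofPred_eq, not_forall, not_lt] at hS
      obtain ⟨p, hp, j, hj⟩ := hS
      refine Set.mem_iUnion.2 ⟨j, ⟨p, hp⟩, ?_⟩
      rw [toReal_empDist_apply S (hAm j ⟨p, hp⟩)] at hj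
      calc k * ε ≤ k * |(k : ℝ)⁻¹ * ∑ t, (A j ⟨p, hp⟩).indicator 1 (S t) -
            D.real (A j ⟨p, hp⟩)| := by gcongr; exact hj
        _ = _ := by
          rw [← abs_of_pos hk0, ← abs_mul, abs_of_pos hk0]
          congr 1
          field_simp
  have hunion : μ (⋃ j, bad j) ≤ ENNReal.ofReal δ := by
    calc μ (⋃ j, bad j) ≤ ∑ j, μ (bad j) := measure_iUnion_fintype_le _ _
      _ ≤ ∑ _j : Fin m, ENNReal.ofReal (δ / m) := Finset.sum_le_sum fun j _ => hbadle j
      _ = ENNReal.ofReal δ := by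
        rw [Finset.sum_const, Finset.card_univ, Fintype.card_fin, nsmul_eq_mul,
          ← ENNReal.ofReal_natCast, ← ENNReal.ofReal_mul (by positivity)]
        congr 1
        field_simp
  have hone : 1 ≤ μ good + ENNReal.ofReal δ := by
    calc (1 : ℝ≥0∞) = μ Set.univ := measure_univ.symm
      _ ≤ μ good + μ (⋃ j, bad j) := (measure_mono hcover).trans (measure_union_le _ _)
      _ ≤ _ := by gcongr
  rw [ge_iff_le, ENNReal.ofReal_sub _ hδ.le, ENNReal.ofReal_one]
  exact tsub_le_iff_right.2 hone
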